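/- Let A_{-1}, A_0, A_1, G be as in the context, with G𝟙 = 𝟙, and let σ < 1 be a real number such that (A_{-1} − A_1)𝟙 ≥ (1 − σ)𝟙 entrywise. Then I − A_0 and I − A_0 − A_1G are invertible in B(ℓ∞) and, with H_2 := (I − A_0)^{-1}(A_1 + A_1G) and H_3 := (I − A_0 − A_1G)^{-1}A_1, one has ‖H_3‖ ≤ ‖H_2‖ ≤ σ. -/

import Mathlib

open BoundedContinuousFunction Filter

noncomputable section

/-- ℓ∞: the Banach space of bounded real sequences with the sup norm. -/
abbrev Linf : Type := BoundedContinuousFunction ℕ ℝ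

/-- A sequence is nonnegative if all its entries are nonnegative. -/
def vnonneg (x : Linf) : Prop := ∀ i, 0 ≤ x i

/-- An operator in B(ℓ∞) is positive if it maps nonnegative sequences to
nonnegative sequences. -/
def OpPos (A : Linf →L[ℝ] Linf) : Prop := ∀ x : Linf, vnonneg x → vnonneg (A x)

/-- The constant sequence with all entries equal to one. -/
def ones : Linf := BoundedContinuousFunction.const ℕ (1 : ℝ)

theorem OpPos.mono {T : Linf →L[ℝ] Linf} (hT : OpPos T) {x y : Linf}
    (h : ∀ i, x i ≤ y i) (i : ℕ) : T x i ≤ T y i := by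
  have := hT (y - x) (fun j => by simpa using h j) i
  rw [map_sub] at this
  simpa using this

theorem OpPos.add {S T : Linf →L[ℝ] Linf} (hS : OpPos S) (hT : OpPos T) : OpPos (S + T) :=
  fun x hx i => add_nonneg (hS x hx i) (hT x hx i)

theorem OpPos.mul {S T : Linf →L[ℝ] Linf} (hS : OpPos S) (hT : OpPos T) : OpPos (S * T) :=
  fun x hx => hS _ (hT x hx)

theorem ones_apply (i : ℕ) : ones i = 1 := rfl

theorem vnonneg_ones : vnonneg ones := fun i => by simp [ones_apply]

/-- If `x` is bounded above by `c`, then `T x` is bounded above by `c • T ones`. -/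
theorem OpPos.apply_le_smul {T : Linf →L[ℝ] Linf} (hT : OpPos T) {x : Linf} {c : ℝ}
    (h : ∀ i, x i ≤ c) (i : ℕ) : T x i ≤ c * T ones i := by
  have := hT.mono (x := x) (y := c • ones) (fun j => by simpa [ones_apply] using h j) i
  rw [map_smul] at this
  simpa using this

/-- The norm of a positive operator is controlled by its value at `ones`. -/
theorem OpPos.norm_le {T : Linf →L[ℝ] Linf} (hT : OpPos T) {k : ℝ} (hk : 0 ≤ k)
    (h : ∀ i, T ones i ≤ k) : ‖T‖ ≤ k := by
  refine T.opNorm_le_bound hk fun x => ?_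
  refine (BoundedContinuousFunction.norm_le (by positivity)).2 fun i => ?_
  have hx (j : ℕ) : |x j| ≤ ‖x‖ := x.norm_coe_le_norm j
  have h1 := hT.apply_le_smul (fun j => (abs_le.1 (hx j)).2) i
  have h2 := hT.apply_le_smul (x := -x) (c := ‖x‖)
    (fun j => by simpa using neg_le.1 (abs_le.1 (hx j)).1) i
  rw [map_neg, BoundedContinuousFunction.neg_apply] at h2
  have h3 := mul_le_mul_of_nonneg_left (h i) (norm_nonneg x)
  rw [Real.norm_eq_abs, abs_le]
  constructor <;> linarith

theorem apply_ones_le_norm (T : Linf →L[ℝ] Linf) (i : ℕ) : T ones i ≤ ‖T‖ := by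
  have h1 : ‖ones‖ ≤ 1 :=
    (BoundedContinuousFunction.norm_le zero_le_one).2 fun j => by simp [ones_apply]
  exact (le_abs_self _).trans
    (((T ones).norm_coe_le_norm i).trans (T.le_of_opNorm_le_of_le le_rfl h1 |>.trans_eq (mul_one _)))

/-- Maximum principle: if `T` is positive with `T ones ≤ k < 1` and `T y ≤ y`, then `0 ≤ y`. -/
theorem OpPos.vnonneg_of_apply_le {T : Linf →L[ℝ] Linf} (hT : OpPos T) {k : ℝ} (hk : 0 ≤ k)
    (hk1 : k < 1) (h : ∀ i, T ones i ≤ k) {y : Linf} (hy : ∀ i, T y i ≤ y i) : vnonneg y := by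
  have key (n : ℕ) : ∀ i, -y i ≤ k ^ n * ‖y‖ := by
    induction n with
    | zero =>
      intro i
      simpa using (neg_le_abs (y i)).trans (y.norm_coe_le_norm i)
    | succ n ih =>
      intro i
      have h1 := hT.apply_le_smul (x := -y) ih i
      rw [map_neg, BoundedContinuousFunction.neg_apply] at h1
      have h2 := mul_le_mul_of_nonneg_left (h i) (by positivity : 0 ≤ k ^ n * ‖y‖)
      rw [pow_succ]
      linarith [hy i]
  intro i
  have hlim : Tendsto (fun n : ℕ => k ^ n * ‖y‖) atTop (nhds (0 * ‖y‖)) :=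
    (tendsto_pow_atTop_nhds_zero_of_lt_one hk hk1).mul_const _
  have := ge_of_tendsto' hlim fun n => key n i
  linarith

/-- If `T` is positive with `T ones ≤ k < 1`, then `1 - T` has a positive inverse. -/
theorem OpPos.exists_inverse_one_sub {T : Linf →L[ℝ] Linf} (hT : OpPos T) {k : ℝ} (hk : 0 ≤ k)
    (hk1 : k < 1) (h : ∀ i, T ones i ≤ k) :
    ∃ B : Linf →L[ℝ] Linf, (1 - T) * B = 1 ∧ B * (1 - T) = 1 ∧ OpPos B := by
  obtain ⟨u, hu⟩ := isUnit_one_sub_of_norm_lt_one (x := T) ((hT.norm_le hk h).trans_lt hk1)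
  have hr : (1 - T) * (↑u⁻¹ : Linf →L[ℝ] Linf) = 1 := by rw [← hu, u.mul_inv]
  refine ⟨↑u⁻¹, hr, by rw [← hu, u.inv_mul], fun x hx => ?_⟩
  refine hT.vnonneg_of_apply_le hk hk1 h fun i => ?_
  have h1 : (↑u⁻¹ : Linf →L[ℝ] Linf) x - T ((↑u⁻¹ : Linf →L[ℝ] Linf) x) = x :=
    DFunLike.congr_fun hr x
  have h2 := hx i
  rw [← h1, BoundedContinuousFunction.sub_apply] at h2
  linarith

/-- I - A₀ and I - A₀ - A₁G are invertible and ‖H₃‖ ≤ ‖H₂‖ ≤ σ, where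
H₂ = (I - A₀)⁻¹(A₁ + A₁G) and H₃ = (I - A₀ - A₁G)⁻¹A₁. -/
theorem stmt12
    (Am1 A0 A1 G : Linf →L[ℝ] Linf)
    (hAm1 : OpPos Am1) (hA0 : OpPos A0) (hA1 : OpPos A1) (hG : OpPos G)
    (hstoch : (Am1 + A0 + A1) ones = ones)
    (heq : A1 * G ^ 2 + A0 * G + Am1 = G)
    (hG1 : G ones = ones)
    (σ : ℝ) (hσ : σ < 1)
    (hgap : ∀ i, 1 - σ ≤ ((Am1 - A1) ones) i) :
    ∃ B C : Linf →L[ℝ] Linf,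
      (1 - A0) * B = 1 ∧ B * (1 - A0) = 1 ∧
      (1 - A0 - A1 * G) * C = 1 ∧ C * (1 - A0 - A1 * G) = 1 ∧
      ‖C * A1‖ ≤ ‖B * (A1 + A1 * G)‖ ∧ ‖B * (A1 + A1 * G)‖ ≤ σ := by
  have hc := hA1 ones vnonneg_ones
  have hb := hA0 ones vnonneg_ones
  have hsum (i : ℕ) : A0 ones i + 2 * A1 ones i ≤ σ := by
    have h1 : Am1 ones i + A0 ones i + A1 ones i = 1 := DFunLike.congr_fun hstoch i
    have h2 : 1 - σ ≤ Am1 ones i - A1 ones i := hgap i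
    linarith
  have hσ0 : 0 ≤ σ := by linarith [hsum 0, hc 0, hb 0]
  have hA1G : (A1 * G) ones = A1 ones := congrArg A1 hG1
  have hT : OpPos (A0 + A1 * G) := hA0.add (hA1.mul hG)
  obtain ⟨B, hB1, hB2, hB⟩ := hA0.exists_inverse_one_sub hσ0 hσ
    fun i => by linarith [hsum i, hc i]
  obtain ⟨C, hC1, hC2, hC⟩ := hT.exists_inverse_one_sub hσ0 hσ fun i => by
    rw [_root_.add_apply, hA1G, BoundedContinuousFunction.add_apply]
    linarith [hsum i, hc i]
  have hH2 : OpPos (B * (A1 + A1 * G)) := hB.mul (hA1.add (hA1.mul hG))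
  have hH2_ones : (B * (A1 + A1 * G)) ones = B (A1 ones + A1 ones) := by
    rw [mul_apply_eq_comp, _root_.add_apply, hA1G]
  have hH2_le : ‖B * (A1 + A1 * G)‖ ≤ σ := by
    refine hH2.norm_le hσ0 fun i => ?_
    have h1 : B (σ • (1 - A0) ones) = σ • ones := by
      rw [map_smul]
      exact congrArg (σ • ·) (DFunLike.congr_fun hB2 ones)
    have h2 := hB.mono (x := A1 ones + A1 ones) (y := σ • (1 - A0) ones) (fun j => by
      change A1 ones j + A1 ones j ≤ σ * (1 - A0 ones j)
      nlinarith [hsum j, hb j]) i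
    rw [h1] at h2
    rw [hH2_ones]
    simpa [ones_apply] using h2
  have hsub : 1 - A0 - A1 * G = 1 - (A0 + A1 * G) := sub_sub 1 A0 (A1 * G)
  refine ⟨B, C, hB1, hB2, by rw [hsub, hC1], by rw [hsub, hC2], ?_, hH2_le⟩
  refine (hC.mul hA1).norm_le (norm_nonneg (B * (A1 + A1 * G))) fun i => ?_
  set t := ‖B * (A1 + A1 * G)‖
  set h := (B * (A1 + A1 * G)) ones
  have hle (j : ℕ) : h j ≤ t := apply_ones_le_norm _ j
  have hA0h : h - A0 h = A1 ones + A1 ones := by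
    rw [hH2_ones]
    exact DFunLike.congr_fun hB1 (A1 ones + A1 ones)
  have hCh : C ((1 - (A0 + A1 * G)) h) = h := DFunLike.congr_fun hC2 h
  have hmono := hC.mono (x := A1 ones) (y := (1 - (A0 + A1 * G)) h) (fun j => by
    have h1 : h j - A0 h j = A1 ones j + A1 ones j := DFunLike.congr_fun hA0h j
    have h2 := (hA1.mul hG).apply_le_smul hle j
    rw [hA1G] at h2
    change A1 ones j ≤ h j - (A0 h j + (A1 * G) h j)
    nlinarith [hc j]) i
  rw [hCh] at hmono
  exact hmono.trans (hle i)
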